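/- There is no primitive non-constant arithmetic progression of integers of the form $x_1^2, x_2^2, x_3^5, x_4^2$ (four terms, with exponent pattern $(2,2,5,2)$). -/

import Mathlib

theorem isCoprime_sq_add_sq_mul {u v : ℤ} (huv : IsCoprime u v) :
    IsCoprime (u ^ 2 + v ^ 2) (u * v) := by
  refine IsCoprime.mul_right ?_ ?_
  · rw [add_comm, pow_two u]
    exact (huv.symm.pow_left).add_mul_left_left u
  · rw [pow_two v]
    exact (huv.pow_left).add_mul_left_left v

theorem isCoprime_sq_add_sq_neg_four_mul {u v : ℤ} (huv : IsCoprime u v)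
    (hodd : Odd (u ^ 2 + v ^ 2)) : IsCoprime (u ^ 2 + v ^ 2) (-4 * (u * v)) := by
  have h2 : IsCoprime (u ^ 2 + v ^ 2) 2 := Int.isCoprime_two_right.2 hodd
  have h4 : (-4 : ℤ) = -(2 * 2) := by norm_num
  rw [h4]
  exact (h2.mul_right h2).neg_right.mul_right (isCoprime_sq_add_sq_mul huv)

/-- The ring of integers `ℤ[φ]` of `ℚ(√5)`, where `φ ^ 2 = φ + 1`. -/
abbrev GoldenInt : Type := QuadraticAlgebra ℤ 1 1

namespace GoldenInt

open QuadraticAlgebra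

/-- The golden ratio as an element of `ℤ[φ]`. -/
def phi : GoldenInt := ⟨0, 1⟩

theorem phi_sq : phi ^ 2 = phi + 1 := by
  rw [pow_two]; ext <;> simp [phi]

theorem norm_eq (z : GoldenInt) : z.norm = z.re ^ 2 + z.re * z.im - z.im ^ 2 := by
  rw [norm_def]; ring

theorem norm_eq_zero {z : GoldenInt} (h : z.norm = 0) : z = 0 := by
  rw [norm_eq] at h
  have h5 : (2 * z.re + z.im) ^ 2 = 5 * z.im ^ 2 := by linear_combination 4 * h
  have him : z.im = 0 := by
    by_contra hne
    have hirr : Irrational (√5) := by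
      simpa using Nat.Prime.irrational_sqrt (p := 5) (by norm_num)
    have hne' : (z.im : ℝ) ≠ 0 := by exact_mod_cast hne
    have h5' : (((2 * z.re + z.im : ℤ) : ℝ) / (z.im : ℤ)) ^ 2 = 5 := by
      rw [div_pow, div_eq_iff (pow_ne_zero 2 hne')]
      exact_mod_cast h5
    have hab : √5 = |((2 * z.re + z.im : ℤ) : ℝ) / (z.im : ℤ)| := by
      rw [← h5', Real.sqrt_sq_eq_abs]
    refine hirr ⟨|((2 * z.re + z.im : ℤ) : ℚ) / (z.im : ℤ)|, ?_⟩
    rw [hab]; push_cast; rfl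
  have hre : z.re = 0 := by
    rw [him] at h
    simpa using h
  ext <;> simp [him, hre]

theorem norm_ne_zero {z : GoldenInt} (h : z ≠ 0) : z.norm ≠ 0 := fun h' => h (norm_eq_zero h')

instance : NoZeroDivisors GoldenInt where
  eq_zero_or_eq_zero_of_mul_eq_zero {a b} h := by
    have h' : a.norm * b.norm = 0 := by rw [← map_mul, h, QuadraticAlgebra.norm_zero]
    exact (mul_eq_zero.1 h').imp norm_eq_zero norm_eq_zero

instance : IsDomain GoldenInt := NoZeroDivisors.to_isDomain _

/-- Division in `ℤ[φ]`: round both coordinates of the quotient in `ℚ(√5)`. -/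
def quotient (x y : GoldenInt) : GoldenInt :=
  ⟨round (((x * star y).re : ℚ) / y.norm), round (((x * star y).im : ℚ) / y.norm)⟩

theorem natAbs_norm_sub_mul_quotient_lt (x : GoldenInt) {y : GoldenInt} (hy : y ≠ 0) :
    (x - y * quotient x y).norm.natAbs < y.norm.natAbs := by
  have hn : (y.norm : ℚ) ≠ 0 := by exact_mod_cast norm_ne_zero hy
  set w := x * star y with hw
  set q := quotient x y with hq
  set r := x - y * q with hr
  have hrs : r * star y = ⟨w.re - y.norm * q.re, w.im - y.norm * q.im⟩ := by
    have hyy := algebraMap_norm_eq_mul_star y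
    have h : r * star y = w - algebraMap ℤ GoldenInt y.norm * q := by
      rw [hyy, hr, hw]; ring
    rw [h]
    ext <;> simp
  have hmul : r.norm * y.norm =
      (w.re - y.norm * q.re) ^ 2 + (w.re - y.norm * q.re) * (w.im - y.norm * q.im)
        - (w.im - y.norm * q.im) ^ 2 := by
    rw [← QuadraticAlgebra.norm_star y, ← map_mul, hrs, norm_eq, QuadraticAlgebra.norm_star]
  set a : ℚ := (w.re : ℚ) / y.norm - q.re with ha
  set b : ℚ := (w.im : ℚ) / y.norm - q.im with hb
  have ha' : |a| ≤ 1 / 2 := abs_sub_round _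
  have hb' : |b| ≤ 1 / 2 := abs_sub_round _
  have hquot : (r.norm : ℚ) = y.norm * (a ^ 2 + a * b - b ^ 2) := by
    have hmul' := congrArg (Int.cast : ℤ → ℚ) hmul
    push_cast at hmul'
    apply mul_right_cancel₀ hn
    rw [hmul', ha, hb]
    field_simp
  have hlt : |a ^ 2 + a * b - b ^ 2| < 1 := by
    rw [abs_le] at ha' hb'
    rw [abs_lt]
    constructor <;> nlinarith
  have hfin : |(r.norm : ℚ)| < |(y.norm : ℚ)| := by
    rw [hquot, abs_mul]
    exact mul_lt_of_lt_one_right (abs_pos.2 hn) hlt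
  have hfin' : |r.norm| < |y.norm| := by exact_mod_cast hfin
  zify
  exact hfin'

instance : EuclideanDomain GoldenInt :=
  { (inferInstance : CommRing GoldenInt), (inferInstance : Nontrivial GoldenInt) with
    quotient := quotient
    remainder := fun x y => x - y * quotient x y
    quotient_zero := fun x => by ext <;> simp [quotient]
    quotient_mul_add_remainder_eq := fun x y => by ring
    r := _
    r_wellFounded := (measure fun z : GoldenInt => z.norm.natAbs).wf
    remainder_lt := fun x y hy => natAbs_norm_sub_mul_quotient_lt x hy
    mul_left_not_lt := fun a b hb => not_lt_of_ge <| by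
      show a.norm.natAbs ≤ (a * b).norm.natAbs
      rw [map_mul, Int.natAbs_mul]
      exact Nat.le_mul_of_pos_right _ (Int.natAbs_pos.2 (norm_ne_zero hb)) }

theorem isUnit_iff {z : GoldenInt} : IsUnit z ↔ z.norm = 1 ∨ z.norm = -1 := by
  rw [isUnit_iff_norm_isUnit, Int.isUnit_iff]

theorem norm_phi : phi.norm = -1 := by simp [norm_eq, phi]

theorem phi_mul_phi_sub_one : phi * (phi - 1) = 1 := by linear_combination phi_sq

/-- Up to squares, every unit of `ℤ[φ]` is one of `1, -1, φ, -φ`. -/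
theorem exists_sq_of_isUnit (n : ℕ) : ∀ z : GoldenInt, (z.re ^ 2 + z.im ^ 2).natAbs = n →
    z.norm = 1 ∨ z.norm = -1 →
    ∃ x : GoldenInt, z = x ^ 2 ∨ z = -x ^ 2 ∨ z = phi * x ^ 2 ∨ z = -(phi * x ^ 2) := by
  induction n using Nat.strong_induction_on with
  | _ n ih =>
  intro z hzn hz
  have hmulphi : ∀ x : GoldenInt, (x * phi).re = x.im ∧ (x * phi).im = x.re + x.im := fun x => by
    simp [phi]
  have hmulinv : ∀ x : GoldenInt,
      (x * (phi - 1)).re = x.im - x.re ∧ (x * (phi - 1)).im = x.re := fun x => by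
    constructor
    · simp [phi]; ring
    · simp [phi]
  have hnorm : ∀ x y : GoldenInt, y.norm = -1 → (x.norm = 1 ∨ x.norm = -1) →
      ((x * y).norm = 1 ∨ (x * y).norm = -1) := fun x y hy hx => by
    rw [map_mul, hy]; omega
  have hN := hz
  rw [norm_eq] at hN
  have hlt : z.re * z.im = 0 ∨
      (z.im - z.re) ^ 2 + z.re ^ 2 < z.re ^ 2 + z.im ^ 2 ∨
      z.im ^ 2 + (z.re + z.im) ^ 2 < z.re ^ 2 + z.im ^ 2 := by
    by_contra! hcon
    obtain ⟨h0, h1, h2⟩ := hcon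
    rcases lt_or_gt_of_ne (left_ne_zero_of_mul h0) with ha | ha <;>
    rcases lt_or_gt_of_ne (right_ne_zero_of_mul h0) with hb | hb
    · have : z.re ≤ 2 * z.im := by nlinarith
      rcases hN with hN | hN <;> nlinarith
    · have : -2 * z.re ≤ z.im := by nlinarith
      rcases hN with hN | hN <;> nlinarith
    · have : z.im ≤ -2 * z.re := by nlinarith
      rcases hN with hN | hN <;> nlinarith
    · have : 2 * z.im ≤ z.re := by nlinarith
      rcases hN with hN | hN <;> nlinarith
  rcases hlt with h0 | h1 | h2
  · rcases mul_eq_zero.1 h0 with h | h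
    · rw [h] at hN
      have : z.im = 1 ∨ z.im = -1 := by
        rw [← sq_eq_sq_iff_eq_or_eq_neg]
        rcases hN with hN | hN <;> nlinarith
      refine ⟨1, ?_⟩
      rcases this with h' | h'
      · right; right; left; ext <;> simp [phi, h, h']
      · right; right; right; ext <;> simp [phi, h, h']
    · rw [h] at hN
      have : z.re = 1 ∨ z.re = -1 := by
        rw [← sq_eq_sq_iff_eq_or_eq_neg]
        rcases hN with hN | hN <;> nlinarith
      refine ⟨1, ?_⟩
      rcases this with h' | h'
      · left; ext <;> simp [h, h']
      · right; left; ext <;> simp [h, h']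
  · obtain ⟨x, hx⟩ := ih _ (by
      rw [← hzn, (hmulinv z).1, (hmulinv z).2]
      zify
      rwa [abs_of_nonneg (by positivity), abs_of_nonneg (by positivity)]) (z * (phi - 1)) rfl
      (hnorm _ _ (by simp [norm_eq, phi]) hz)
    have hz' : z = phi * (z * (phi - 1)) := by linear_combination (-z) * phi_mul_phi_sub_one
    rcases hx with hx | hx | hx | hx <;> rw [hx] at hz'
    · exact ⟨x, by right; right; left; exact hz'⟩
    · exact ⟨x, by right; right; right; rw [hz']; ring⟩
    · exact ⟨phi * x, by left; rw [hz']; ring⟩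
    · exact ⟨phi * x, by right; left; rw [hz']; ring⟩
  · obtain ⟨x, hx⟩ := ih _ (by
      rw [← hzn, (hmulphi z).1, (hmulphi z).2]
      zify
      rwa [abs_of_nonneg (by positivity), abs_of_nonneg (by positivity)]) (z * phi) rfl
      (hnorm _ _ norm_phi hz)
    have hz' : z = (z * phi) * (phi - 1) := by linear_combination (-z) * phi_mul_phi_sub_one
    have hs : ∀ y : GoldenInt, y * (phi - 1) = phi * ((phi - 1) ^ 2 * y) := fun y => by
      linear_combination (-y * (phi - 1)) * phi_mul_phi_sub_one
    rcases hx with hx | hx | hx | hx <;> rw [hx] at hz'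
    · exact ⟨(phi - 1) * x, by right; right; left; rw [hz', hs]; ring⟩
    · exact ⟨(phi - 1) * x, by right; right; right; rw [hz', hs]; ring⟩
    · exact ⟨x, by left; rw [hz']; linear_combination x ^ 2 * phi_mul_phi_sub_one⟩
    · exact ⟨x, by right; left; rw [hz']; linear_combination (-x ^ 2) * phi_mul_phi_sub_one⟩

theorem exists_eq_sq_or_neg_sq_of_norm_eq_one {z : GoldenInt} (h : z.norm = 1) :
    ∃ x : GoldenInt, z = x ^ 2 ∨ z = -x ^ 2 := by
  obtain ⟨x, hx | hx | hx | hx⟩ := exists_sq_of_isUnit _ z rfl (Or.inl h)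
  · exact ⟨x, Or.inl hx⟩
  · exact ⟨x, Or.inr hx⟩
  · rw [hx, map_mul, map_pow, norm_phi] at h
    nlinarith [sq_nonneg x.norm]
  · rw [hx, QuadraticAlgebra.norm_neg, map_mul, map_pow, norm_phi] at h
    nlinarith [sq_nonneg x.norm]

/-! ### Primes -/

theorem prime_of_dvd_norm {p : GoldenInt} {l : ℤ} (hl : Prime l) (hp : p.norm ≠ 0)
    (hlp : l ∣ p.norm) (h : ∀ x : GoldenInt, l ∣ x.norm → p ∣ x) : Prime p := by
  refine ⟨fun h0 => hp (by rw [h0, QuadraticAlgebra.norm_zero]), fun hu => ?_, fun a b hab => ?_⟩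
  · apply hl.not_isUnit
    rw [isUnit_iff_norm_isUnit] at hu
    exact isUnit_of_dvd_unit hlp hu
  · have : l ∣ a.norm * b.norm := by
      rw [← map_mul]
      exact hlp.trans (map_dvd QuadraticAlgebra.norm hab)
    exact (hl.dvd_or_dvd this).imp (h a) (h b)

theorem intCast_dvd_of_dvd {n : ℤ} {x : GoldenInt} (h1 : n ∣ x.re) (h2 : n ∣ x.im) :
    (n : GoldenInt) ∣ x := by
  obtain ⟨a, ha⟩ := h1
  obtain ⟨b, hb⟩ := h2
  exact ⟨⟨a, b⟩, by ext <;> simp [ha, hb]⟩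

theorem two_dvd_of_two_dvd_norm {x : GoldenInt} (h : (2 : ℤ) ∣ x.norm) : (2 : GoldenInt) ∣ x := by
  rw [norm_eq] at h
  have : (2 : ℤ) ∣ x.re ∧ (2 : ℤ) ∣ x.im := by
    obtain ⟨a, ha⟩ := Int.even_or_odd' x.re
    obtain ⟨b, hb⟩ := Int.even_or_odd' x.im
    rcases ha with ha | ha <;> rcases hb with hb | hb <;> rw [ha, hb] at h <;> ring_nf at h <;> omega
  exact_mod_cast intCast_dvd_of_dvd this.1 this.2

theorem three_dvd_of_three_dvd_norm {x : GoldenInt} (h : (3 : ℤ) ∣ x.norm) :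
    (3 : GoldenInt) ∣ x := by
  rw [norm_eq] at h
  have key : ∀ a b : ZMod 3, a ^ 2 + a * b - b ^ 2 = 0 → a = 0 ∧ b = 0 := by decide
  have := key x.re x.im (by exact_mod_cast (ZMod.intCast_zmod_eq_zero_iff_dvd _ 3).2 h)
  rw [ZMod.intCast_zmod_eq_zero_iff_dvd, ZMod.intCast_zmod_eq_zero_iff_dvd] at this
  exact_mod_cast intCast_dvd_of_dvd this.1 this.2

theorem two_add_phi_dvd_of_five_dvd_norm {x : GoldenInt} (h : (5 : ℤ) ∣ x.norm) :
    (2 + phi) ∣ x := by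
  rw [norm_eq] at h
  have key : ∀ a b : ZMod 5, a ^ 2 + a * b - b ^ 2 = 0 → 3 * a - b = 0 ∧ 2 * b - a = 0 := by
    decide
  have := key x.re x.im (by exact_mod_cast (ZMod.intCast_zmod_eq_zero_iff_dvd _ 5).2 h)
  obtain ⟨a, ha⟩ := (ZMod.intCast_zmod_eq_zero_iff_dvd (3 * x.re - x.im) 5).1
    (by exact_mod_cast this.1)
  obtain ⟨b, hb⟩ := (ZMod.intCast_zmod_eq_zero_iff_dvd (2 * x.im - x.re) 5).1
    (by exact_mod_cast this.2)
  refine ⟨⟨a, b⟩, ?_⟩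
  ext
  · simp [phi]; push_cast at ha hb; linarith
  · simp [phi]; push_cast at ha hb; linarith

theorem prime_two : Prime (2 : GoldenInt) :=
  prime_of_dvd_norm Int.prime_two (by simp [norm_eq]) (by simp [norm_eq])
    fun _ => two_dvd_of_two_dvd_norm

theorem prime_three : Prime (3 : GoldenInt) :=
  prime_of_dvd_norm Int.prime_three (by simp [norm_eq]) (by simp [norm_eq])
    fun _ => three_dvd_of_three_dvd_norm

theorem norm_two_add_phi : (2 + phi).norm = 5 := by simp [norm_eq, phi]

theorem prime_two_add_phi : Prime (2 + phi) :=
  prime_of_dvd_norm (Int.prime_iff_natAbs_prime.2 (by norm_num)) (by rw [norm_two_add_phi]; simp)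
    (by rw [norm_two_add_phi]) fun _ => two_add_phi_dvd_of_five_dvd_norm

/-! ### Congruences modulo powers of two -/

theorem two_dvd_of_two_dvd_pow {x : GoldenInt} {n : ℕ} (h : 2 ∣ x ^ n) : 2 ∣ x :=
  prime_two.dvd_of_dvd_pow h

theorem isCoprime_two_pow {x : GoldenInt} (h : ¬ 2 ∣ x) (n : ℕ) : IsCoprime (2 ^ n) x :=
  ((Irreducible.coprime_iff_not_dvd prime_two.irreducible).2 h).pow_left

theorem sq_norm_modEq {x : GoldenInt} (h : ¬ 2 ∣ x) : (8 : ℤ) ∣ x.norm ^ 2 - 1 := by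
  have hodd : ¬ (2 : ℤ) ∣ x.norm := fun h' => h (two_dvd_of_two_dvd_norm h')
  obtain ⟨a, ha⟩ := Int.even_or_odd' x.norm
  have ha : x.norm = 2 * a + 1 := by omega
  obtain ⟨b, hb⟩ := Int.even_mul_succ_self a
  exact ⟨b, by rw [ha]; linear_combination 4 * hb⟩

theorem dvd_norm_sub_norm {n : ℤ} {x y : GoldenInt} (h : (n : GoldenInt) ∣ x - y) :
    n ∣ x.norm - y.norm := by
  obtain ⟨t, ht⟩ := h
  obtain rfl : x = y + n * t := by linear_combination ht
  refine ⟨2 * y.re * t.re + n * t.re ^ 2 + (y.re * t.im + y.im * t.re) + n * t.re * t.im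
    - 2 * y.im * t.im - n * t.im ^ 2, ?_⟩
  simp [norm_eq]
  ring

/-- `-1` is not a square of an odd element modulo `4`. -/
theorem not_four_dvd_sq_add_sq {w a : GoldenInt} (ha : ¬ 2 ∣ a) : ¬ 4 ∣ w ^ 2 + a ^ 2 := by
  rintro ⟨t, ht⟩
  have h1 : 2 ∣ w - a := by
    apply two_dvd_of_two_dvd_pow (n := 2)
    exact ⟨2 * t - w * a, by linear_combination ht⟩
  obtain ⟨s, hs⟩ := h1
  apply ha
  apply two_dvd_of_two_dvd_pow (n := 2)
  have h2 : (2 : GoldenInt) * a ^ 2 = 2 * (2 * (t - a * s - s ^ 2)) := by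
    linear_combination ht - (w + a + 2 * s) * hs
  exact ⟨_, mul_left_cancel₀ prime_two.ne_zero h2⟩

theorem not_two_dvd_of_dvd_sub {x y : GoldenInt} (h : 2 ∣ x - y) (hy : ¬ 2 ∣ y) : ¬ 2 ∣ x :=
  fun hx => hy ((dvd_sub_right hx).1 h)

theorem eight_dvd_norm_sub_one {x a : GoldenInt} (ha : ¬ 2 ∣ a) (h : 8 ∣ x - a ^ 2) :
    (8 : ℤ) ∣ x.norm - 1 := by
  have h1 := dvd_norm_sub_norm (n := 8) (x := x) (y := a ^ 2) (by exact_mod_cast h)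
  rw [map_pow] at h1
  have := dvd_add h1 (sq_norm_modEq ha)
  rwa [sub_add_sub_cancel] at this

/-- The norm of a number of the form `e * c * y ^ 2` modulo `8`, for a unit `e`. -/
theorem norm_unit_mul_sq {e c y x : GoldenInt} (he : IsUnit e) (hx : x = e * c * y ^ 2)
    (hodd : ¬ 2 ∣ x) :
    (e.norm = 1 ∧ (8 : ℤ) ∣ x.norm - c.norm) ∨ (e.norm = -1 ∧ (8 : ℤ) ∣ x.norm + c.norm) := by
  have hy : ¬ 2 ∣ y := fun h => hodd (by
    rw [hx]; exact Dvd.dvd.mul_left (dvd_pow h two_ne_zero) _)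
  obtain ⟨t, ht⟩ := sq_norm_modEq hy
  have hn : x.norm = e.norm * c.norm * y.norm ^ 2 := by rw [hx, map_mul, map_mul, map_pow]
  rcases isUnit_iff.1 he with h | h
  · left; refine ⟨h, c.norm * t, ?_⟩
    rw [hn, h]; linear_combination c.norm * ht
  · right; refine ⟨h, -c.norm * t, ?_⟩
    rw [hn, h]; linear_combination -c.norm * ht

theorem exists_eq_mul_sq_or_neg {e c y x a : GoldenInt} (he : IsUnit e) (hx : x = e * c * y ^ 2)
    (ha : ¬ 2 ∣ a) (h : 8 ∣ x - a ^ 2) (hc : (8 : ℤ) ∣ c.norm - 1) :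
    ∃ b, x = c * b ^ 2 ∨ x = -(c * b ^ 2) := by
  have hodd : ¬ 2 ∣ x := not_two_dvd_of_dvd_sub (y := a ^ 2)
    (dvd_trans ⟨4, by norm_num⟩ h) fun h' => ha (two_dvd_of_two_dvd_pow h')
  have h8 := eight_dvd_norm_sub_one ha h
  have he1 : e.norm = 1 := by
    rcases norm_unit_mul_sq he hx hodd with h' | h' <;> omega
  obtain ⟨b, hb | hb⟩ := exists_eq_sq_or_neg_sq_of_norm_eq_one he1
  · exact ⟨b * y, Or.inl (by rw [hx, hb]; ring)⟩
  · exact ⟨b * y, Or.inr (by rw [hx, hb]; ring)⟩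

theorem exists_eq_sq {e y x a : GoldenInt} (he : IsUnit e) (hx : x = e * y ^ 2)
    (ha : ¬ 2 ∣ a) (h : 8 ∣ x - a ^ 2) : ∃ b, x = b ^ 2 := by
  obtain ⟨b, hb | hb⟩ := exists_eq_mul_sq_or_neg (c := 1) (y := y) he (by rw [hx]; ring) ha h (by simp)
  · exact ⟨b, by rw [hb, one_mul]⟩
  · exfalso
    apply not_four_dvd_sq_add_sq (w := b) ha
    obtain ⟨t, ht⟩ := h
    exact ⟨-2 * t, by linear_combination -ht + hb⟩

theorem exists_eq_sq_or_eq_neg_three_mul {e y x a : GoldenInt} (he : IsUnit e)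
    (hx : x = e * 3 * y ^ 2) (ha : ¬ 2 ∣ a) (h : 8 ∣ x - a ^ 2) : ∃ b, x = -(3 * b ^ 2) := by
  obtain ⟨b, hb | hb⟩ := exists_eq_mul_sq_or_neg he hx ha h (by simp [norm_eq])
  · exfalso
    apply not_four_dvd_sq_add_sq (w := b) ha
    obtain ⟨t, ht⟩ := h
    exact ⟨b ^ 2 - 2 * t, by linear_combination -ht + hb⟩
  · exact ⟨b, hb⟩

theorem false_of_norm_eq_five {e c y x a : GoldenInt} (he : IsUnit e) (hx : x = e * c * y ^ 2)
    (ha : ¬ 2 ∣ a) (h : 8 ∣ x - a ^ 2) (hc : (8 : ℤ) ∣ c.norm - 5) : False := by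
  have hodd : ¬ 2 ∣ x := not_two_dvd_of_dvd_sub (y := a ^ 2)
    (dvd_trans ⟨4, by norm_num⟩ h) fun h' => ha (two_dvd_of_two_dvd_pow h')
  have h8 := eight_dvd_norm_sub_one ha h
  rcases norm_unit_mul_sq he hx hodd with h' | h' <;> omega

/-! ### Coprime factors of squares -/

theorem exists_unit_mul_sq {u v c s : GoldenInt} (hc : IsUnit c) (huv : IsCoprime u v)
    (h : u * v = c * s ^ 2) : ∃ e y, IsUnit e ∧ u = e * y ^ 2 := by
  obtain ⟨c', rfl⟩ := hc
  have h' : u * (↑c'⁻¹ * v) = s ^ 2 := by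
    linear_combination (↑c'⁻¹ : GoldenInt) * h + s ^ 2 * c'.inv_mul
  have hcop : IsCoprime u (↑c'⁻¹ * v) := (isCoprime_mul_unit_left_right c'⁻¹.isUnit u v).2 huv
  obtain ⟨d, e, hd⟩ := exists_associated_pow_of_mul_eq_pow' hcop h'
  exact ⟨e, d, e.isUnit, by rw [← hd, mul_comm]⟩

theorem exists_unit_mul_sq_of_prime {u v p c s : GoldenInt} (hp : Prime p) (hc : IsUnit c)
    (huv : IsCoprime u v) (h : u * v = c * p * s ^ 2) :
    ∃ e y, IsUnit e ∧ (u = e * y ^ 2 ∨ u = e * p * y ^ 2) := by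
  have hdvd : p ∣ u * v := ⟨c * s ^ 2, by rw [h]; ring⟩
  rcases hp.dvd_or_dvd hdvd with ⟨t, rfl⟩ | ⟨t, rfl⟩
  · obtain ⟨e, y, he, hy⟩ := exists_unit_mul_sq (s := s) hc huv.of_mul_left_right
      (mul_left_cancel₀ hp.ne_zero (by linear_combination h))
    exact ⟨e, y, he, Or.inr (by rw [hy]; ring)⟩
  · obtain ⟨e, y, he, hy⟩ := exists_unit_mul_sq (s := s) (u := u) hc huv.of_mul_right_right
      (mul_left_cancel₀ hp.ne_zero (by linear_combination h))
    exact ⟨e, y, he, Or.inl hy⟩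

theorem isCoprime_of_mul_sub {a s c v : GoldenInt} (hc : Squarefree c) (h : IsCoprime a s)
    (hv : v * (a - v) = c * s ^ 2) : IsCoprime v (a - v) := by
  apply isCoprime_of_prime_dvd
  · rintro ⟨rfl, h0⟩
    have ha : a = 0 := by simpa using h0
    have hs : s = 0 := by simpa [hc.ne_zero] using hv.symm
    rw [ha, hs] at h
    exact not_isCoprime_zero_zero h
  · intro p hp h1 h2
    have hpa : p ∣ a := by simpa using dvd_add h2 h1
    have hps : IsCoprime (p * p) (s ^ 2) :=
      IsCoprime.pow_right (IsCoprime.mul_left (h.of_isCoprime_of_dvd_left hpa)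
        (h.of_isCoprime_of_dvd_left hpa))
    have : p * p ∣ c * s ^ 2 := hv ▸ mul_dvd_mul h1 h2
    exact hp.not_isUnit (hc p (hps.dvd_of_dvd_mul_right this))

/-! ### A real embedding -/

/-- The embedding `ℤ[φ] → ℝ` which maps `φ` to its negative conjugate. -/
noncomputable def toReal : GoldenInt →+* ℝ :=
  (QuadraticAlgebra.lift (R := ℤ) (a := 1) (b := 1) (A := ℝ)
    ⟨Real.goldenConj, by simp [← pow_two, Real.goldenConj_sq, add_comm]⟩).toRingHom

theorem toReal_phi : toReal phi = Real.goldenConj := by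
  simp [toReal, phi]

theorem toReal_intCast (n : ℤ) : toReal n = n := map_intCast _ n

theorem toReal_ne_zero {x : GoldenInt} (h : x ≠ 0) : toReal x ≠ 0 := by
  intro h0
  have h1 := congrArg toReal (algebraMap_norm_eq_mul_star x)
  rw [map_mul, h0, zero_mul] at h1
  apply norm_ne_zero h
  have h2 : toReal ((x.norm : ℤ) : GoldenInt) = 0 := by simpa using h1
  rw [toReal_intCast] at h2
  exact_mod_cast h2

/-! ### The descent -/

theorem exists_eq_mul_isCoprime {a : GoldenInt} (q : GoldenInt) (ha : a ≠ 0) :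
    ∃ e a' q', a = e * a' ∧ q = e * q' ∧ IsCoprime a' q' := by
  classical
  obtain ⟨a', ha'⟩ := EuclideanDomain.gcd_dvd_left a q
  obtain ⟨q', hq'⟩ := EuclideanDomain.gcd_dvd_right a q
  have hab := EuclideanDomain.gcd_eq_gcd_ab a q
  set e := EuclideanDomain.gcd a q
  set x := EuclideanDomain.gcdA a q
  set y := EuclideanDomain.gcdB a q
  have he : e ≠ 0 := fun h => ha (by rw [ha', h, zero_mul])
  refine ⟨e, a', q', ha', hq', x, y, mul_left_cancel₀ he ?_⟩
  linear_combination -hab - x * ha' - y * hq'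

theorem two_dvd_sub_of_two_dvd_sq_sub_sq {x y : GoldenInt} (h : 2 ∣ x ^ 2 - y ^ 2) :
    2 ∣ x - y := by
  obtain ⟨t, ht⟩ := h
  exact two_dvd_of_two_dvd_pow (n := 2) ⟨t + y ^ 2 - x * y, by linear_combination ht⟩

theorem not_two_dvd_mul {x y : GoldenInt} (hx : ¬ 2 ∣ x) (hy : ¬ 2 ∣ y) : ¬ 2 ∣ x * y :=
  fun h => (prime_two.dvd_or_dvd h).elim hx hy

theorem dvd_of_sq_eq_sub {e x b c s : GoldenInt} (hx : e ∣ x) (hs : e ∣ s)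
    (h : x ^ 2 - b ^ 2 = c * s ^ 2) : e ∣ b := by
  rw [← IsIntegrallyClosed.pow_dvd_pow_iff two_ne_zero]
  have : b ^ 2 = x ^ 2 - c * s ^ 2 := by linear_combination -h
  rw [this]
  exact dvd_sub (pow_dvd_pow_of_dvd hx 2) (Dvd.dvd.mul_left (pow_dvd_pow_of_dvd hs 2) c)

/-- A solution of `a² - b² = 3φ²s²`, `a² - c² = (2 + φ)s²` with `a` odd, where `s = 2ᵏq` and `q`
is congruent to `a` modulo `2`. -/
structure IsDescentTuple (k : ℕ) (a b c q : GoldenInt) : Prop where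
  odd : ¬ 2 ∣ a
  two_dvd : 2 ∣ q - a
  left : a ^ 2 - b ^ 2 = 3 * phi ^ 2 * (2 ^ k * q) ^ 2
  right : a ^ 2 - c ^ 2 = (2 + phi) * (2 ^ k * q) ^ 2

theorem IsDescentTuple.exists_isCoprime {k : ℕ} {a b c q : GoldenInt}
    (h : IsDescentTuple k a b c q) :
    ∃ a' b' c' q', IsDescentTuple k a' b' c' q' ∧ IsCoprime a' q' := by
  have ha : a ≠ 0 := fun h' => h.odd (h' ▸ dvd_zero 2)
  obtain ⟨e, a', q', rfl, rfl, hcop⟩ := exists_eq_mul_isCoprime q ha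
  obtain ⟨hodd, h2, hl, hr⟩ := h
  have he : e ≠ 0 := left_ne_zero_of_mul ha
  have hs : e ∣ 2 ^ k * (e * q') := ⟨2 ^ k * q', by ring⟩
  obtain ⟨b', rfl⟩ := dvd_of_sq_eq_sub (dvd_mul_right _ _) hs hl
  obtain ⟨c', rfl⟩ := dvd_of_sq_eq_sub (dvd_mul_right _ _) hs hr
  refine ⟨a', b', c', q', ⟨fun h' => hodd (Dvd.dvd.mul_left h' e), ?_, ?_, ?_⟩, hcop⟩
  · rw [← mul_sub] at h2
    exact (prime_two.dvd_or_dvd h2).resolve_left fun h' => hodd (Dvd.dvd.mul_right h' a')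
  · exact mul_left_cancel₀ (pow_ne_zero 2 he) (by linear_combination hl)
  · exact mul_left_cancel₀ (pow_ne_zero 2 he) (by linear_combination hr)

theorem exists_even_mul_sub {a b c s : GoldenInt} (h : a ^ 2 - b ^ 2 = c * (2 * s) ^ 2)
    (hs : 2 ∣ s) : ∃ v, 2 ∣ v ∧ v * (a - v) = c * s ^ 2 := by
  obtain ⟨v, hv⟩ := two_dvd_sub_of_two_dvd_sq_sub_sq (x := a) (y := b)
    ⟨c * 2 * s ^ 2, by rw [h]; ring⟩
  have hprod : v * (a - v) = c * s ^ 2 := by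
    apply mul_left_cancel₀ (pow_ne_zero 2 prime_two.ne_zero)
    linear_combination h + (2 * v - a - b) * hv
  have h2 : 2 ∣ v * (a - v) := by
    rw [hprod]; exact Dvd.dvd.mul_left (dvd_pow hs two_ne_zero) c
  rcases prime_two.dvd_or_dvd h2 with h' | h'
  · exact ⟨v, h', hprod⟩
  · exact ⟨a - v, h', by linear_combination hprod⟩

theorem not_two_dvd_sub {a v : GoldenInt} (ha : ¬ 2 ∣ a) (hv : 2 ∣ v) : ¬ 2 ∣ a - v :=
  fun h => ha ((dvd_sub_left hv).1 h)

theorem two_pow_dvd_of_mul_sub {a v c s : GoldenInt} {n : ℕ} (ha : ¬ 2 ∣ a) (hv : 2 ∣ v)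
    (h : v * (a - v) = c * s ^ 2) (hs : 2 ^ n ∣ s) : 2 ^ (n * 2) ∣ v := by
  refine (isCoprime_two_pow (not_two_dvd_sub ha hv) _).dvd_of_dvd_mul_right ?_
  rw [h, pow_mul]
  exact Dvd.dvd.mul_left (pow_dvd_pow_of_dvd hs 2) c

theorem isUnit_phi : IsUnit phi := IsUnit.of_mul_eq_one _ phi_mul_phi_sub_one

theorem squarefree_three_mul_phi_sq : Squarefree (3 * phi ^ 2) := by
  have : Associated 3 (3 * phi ^ 2) := associated_mul_unit_right _ _ (isUnit_phi.pow 2)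
  exact (this.irreducible prime_three.irreducible).squarefree

theorem toReal_two_add_phi_pos : 0 < toReal (2 + phi) := by
  rw [map_add, toReal_phi, map_ofNat]
  linarith [Real.neg_one_lt_goldenConj]

theorem toReal_sq_pos {x : GoldenInt} (h : x ≠ 0) : 0 < toReal x ^ 2 :=
  sq_pos_of_ne_zero (toReal_ne_zero h)

/-- The square classes of the factors of a descent tuple. -/
theorem IsDescentTuple.exists_factors {k : ℕ} {a b c q : GoldenInt}
    (h : IsDescentTuple (k + 2) a b c q) (hcop : IsCoprime a q) :
    ∃ v₁ v₂ e₁ e₂ e₃ x₁ x₂ x₃ : GoldenInt, 2 ∣ v₁ ∧ 2 ∣ v₂ ∧ IsUnit e₁ ∧ IsUnit e₂ ∧ IsUnit e₃ ∧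
      v₁ * (a - v₁) = 3 * phi ^ 2 * (2 ^ (k + 1) * q) ^ 2 ∧
      v₂ * (a - v₂) = (2 + phi) * (2 ^ (k + 1) * q) ^ 2 ∧
      (a - v₁ = e₁ * x₁ ^ 2 ∨ a - v₁ = e₁ * 3 * x₁ ^ 2) ∧
      (a - v₂ = e₂ * x₂ ^ 2 ∨ a - v₂ = e₂ * (2 + phi) * x₂ ^ 2) ∧
      a - v₁ - v₂ = e₃ * x₃ ^ 2 := by
  obtain ⟨hodd, h2, hl, hr⟩ := h
  set s := 2 ^ (k + 1) * q with hs
  have hs2 : 2 ^ (k + 2) * q = 2 * s := by rw [hs]; ring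
  rw [hs2] at hl hr
  have h2s : 2 ∣ s := ⟨2 ^ k * q, by rw [hs]; ring⟩
  obtain ⟨v₁, hv₁, h₁⟩ := exists_even_mul_sub hl h2s
  obtain ⟨v₂, hv₂, h₂⟩ := exists_even_mul_sub hr h2s
  have has : IsCoprime a s := IsCoprime.mul_right (isCoprime_two_pow hodd _).symm hcop
  have hc₁ := isCoprime_of_mul_sub squarefree_three_mul_phi_sq has h₁
  have hc₂ := isCoprime_of_mul_sub prime_two_add_phi.irreducible.squarefree has h₂
  have has' : IsCoprime (a - 2 * v₁) s := by
    rw [← IsCoprime.pow_left_iff (m := 2) two_pos]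
    have : (a - 2 * v₁) ^ 2 = a ^ 2 + s * (-4 * (3 * phi ^ 2 * s)) := by
      linear_combination -4 * h₁
    rw [this]
    exact has.pow_left.add_mul_left_left _
  have hu : IsUnit (-phi ^ 3) := (isUnit_phi.pow 3).neg
  have h₃ : (v₂ - v₁) * (a - 2 * v₁ - (v₂ - v₁)) = -phi ^ 3 * s ^ 2 := by
    linear_combination h₂ - h₁ + s ^ 2 * (phi - 2) * phi_sq
  have hc₃ := isCoprime_of_mul_sub hu.squarefree has' h₃
  obtain ⟨e₁, x₁, he₁, hx₁⟩ := exists_unit_mul_sq_of_prime (s := s) prime_three (isUnit_phi.pow 2)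
    hc₁.symm (by linear_combination h₁)
  obtain ⟨e₂, x₂, he₂, hx₂⟩ := exists_unit_mul_sq_of_prime (s := s) prime_two_add_phi isUnit_one
    hc₂.symm (by linear_combination h₂)
  obtain ⟨e₃, x₃, he₃, hx₃⟩ := exists_unit_mul_sq (s := s) hu hc₃.symm (by linear_combination h₃)
  exact ⟨v₁, v₂, e₁, e₂, e₃, x₁, x₂, x₃, hv₁, hv₂, he₁, he₂, he₃, h₁, h₂, hx₁, hx₂,
    by linear_combination hx₃⟩

theorem not_isDescentTuple_two {a b c q : GoldenInt} : ¬ IsDescentTuple 2 a b c q := by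
  intro h
  obtain ⟨a, b, c, q, h, hcop⟩ := h.exists_isCoprime
  obtain ⟨v₁, v₂, e₁, e₂, e₃, x₁, x₂, x₃, hv₁, hv₂, he₁, he₂, he₃, h₁, h₂, hx₁, hx₂, hx₃⟩ :=
    h.exists_factors (k := 0) hcop
  have hodd := h.odd
  obtain ⟨w₁, hw₁⟩ := two_pow_dvd_of_mul_sub (n := 1) hodd hv₁ h₁ ⟨q, by ring⟩
  obtain ⟨w₂, hw₂⟩ := two_pow_dvd_of_mul_sub (n := 1) hodd hv₂ h₂ ⟨q, by ring⟩
  obtain ⟨t, ht⟩ := h.two_dvd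
  have hw : w₂ * (a - 4 * w₂) = (2 + phi) * q ^ 2 := by
    apply mul_left_cancel₀ (pow_ne_zero 2 prime_two.ne_zero)
    rw [hw₂] at h₂
    linear_combination h₂
  have hq : q = a + 2 * t := by linear_combination ht
  have h2 : 2 ∣ a * (w₂ - phi * a) := by
    rw [hq] at hw
    exact ⟨2 * w₂ ^ 2 + a ^ 2 + (2 + phi) * (2 * a * t + 2 * t ^ 2), by linear_combination hw⟩
  obtain ⟨r, hr⟩ := (prime_two.dvd_or_dvd h2).resolve_left hodd
  have h8 : (8 : ℤ) ∣ ((a - v₁) * (a - v₁ - v₂)).norm - (a ^ 2 * (1 - 4 * phi)).norm := by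
    apply dvd_norm_sub_norm
    refine ⟨-a * w₁ - a * r + 2 * w₁ ^ 2 + 2 * w₁ * w₂, ?_⟩
    rw [hw₁, hw₂]
    push_cast
    linear_combination -4 * a * hr
  have hnorm : (a ^ 2 * (1 - 4 * phi)).norm = a.norm ^ 2 * (-19) := by
    rw [map_mul, map_pow]
    simp [norm_eq, phi]
  rw [hnorm] at h8
  have ha8 := sq_norm_modEq hodd
  have hodd' : ¬ 2 ∣ (a - v₁) * (a - v₁ - v₂) :=
    not_two_dvd_mul (not_two_dvd_sub hodd hv₁) (not_two_dvd_sub (not_two_dvd_sub hodd hv₁) hv₂)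
  rcases hx₁ with hx₁ | hx₁
  · rcases norm_unit_mul_sq (c := 1) (y := x₁ * x₃) (x := (a - v₁) * (a - v₁ - v₂))
      (he₁.mul he₃) (by rw [hx₃, hx₁]; ring) hodd' with h' | h' <;>
    rw [QuadraticAlgebra.norm_one] at h' <;> omega
  · have h9 : (3 : GoldenInt).norm = 9 := by simp [norm_eq]
    rcases norm_unit_mul_sq (c := 3) (y := x₁ * x₃) (x := (a - v₁) * (a - v₁ - v₂))
      (he₁.mul he₃) (by rw [hx₃, hx₁]; ring) hodd' with h' | h' <;>
    rw [h9] at h' <;> omega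

theorem IsDescentTuple.exists_descent {k : ℕ} {a b c q : GoldenInt}
    (h : IsDescentTuple (k + 3) a b c q) : ∃ a' b' c' q', IsDescentTuple (k + 2) a' b' c' q' := by
  obtain ⟨a, b, c, q, h, hcop⟩ := h.exists_isCoprime
  obtain ⟨v₁, v₂, e₁, e₂, e₃, x₁, x₂, x₃, hv₁, hv₂, he₁, he₂, he₃, h₁, h₂, hx₁, hx₂, hx₃⟩ :=
    h.exists_factors (k := k + 1) hcop
  have hodd := h.odd
  obtain ⟨w₁, hw₁⟩ := two_pow_dvd_of_mul_sub (n := 2) hodd hv₁ h₁ ⟨2 ^ k * q, by ring⟩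
  obtain ⟨w₂, hw₂⟩ := two_pow_dvd_of_mul_sub (n := 2) hodd hv₂ h₂ ⟨2 ^ k * q, by ring⟩
  have hu₁ := not_two_dvd_sub hodd hv₁
  have hu₂ := not_two_dvd_sub hodd hv₂
  have hu₃ := not_two_dvd_sub hu₁ hv₂
  have hne : ∀ {x : GoldenInt}, ¬ 2 ∣ x → x ≠ 0 := fun hx h0 => hx (h0 ▸ dvd_zero 2)
  have h8₁ : 8 ∣ (a - v₁) * (a - v₁ - v₂) - a ^ 2 := by
    rw [hw₁, hw₂]
    exact ⟨-2 * (2 * w₁ + w₂) * a + 32 * w₁ * (w₁ + w₂), by ring⟩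
  have h8₂ : 8 ∣ (a - v₂) * (a - v₁ - v₂) - a ^ 2 := by
    rw [hw₁, hw₂]
    exact ⟨-2 * (w₁ + 2 * w₂) * a + 32 * w₂ * (w₁ + w₂), by ring⟩
  obtain ⟨r₂, hr₂⟩ : ∃ r, (a - v₂) * (a - v₁ - v₂) = r ^ 2 := by
    rcases hx₂ with hx₂ | hx₂
    · exact exists_eq_sq (y := x₂ * x₃) (he₂.mul he₃) (by rw [hx₂, hx₃]; ring) hodd h8₂
    · exact (false_of_norm_eq_five (c := 2 + phi) (y := x₂ * x₃) (he₂.mul he₃)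
        (by rw [hx₂, hx₃]; ring) hodd h8₂ (by rw [norm_two_add_phi]; simp)).elim
  obtain ⟨r₁, hr₁⟩ : ∃ r, (a - v₁) * (a - v₁ - v₂) = r ^ 2 := by
    rcases hx₁ with hx₁ | hx₁
    · exact exists_eq_sq (y := x₁ * x₃) (he₁.mul he₃) (by rw [hx₃, hx₁]; ring) hodd h8₁
    · obtain ⟨r, hr⟩ := exists_eq_sq_or_eq_neg_three_mul (y := x₁ * x₃) (he₁.mul he₃)
        (by rw [hx₃, hx₁]; ring) hodd h8₁
      exfalso
      have hr0 : r ≠ 0 := by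
        rintro rfl
        exact hne (not_two_dvd_mul hu₁ hu₃) (by rw [hr]; ring)
      have key : -(3 * r ^ 2) * (a - v₂) ^ 2
          = (r₂ ^ 2 + (2 + phi) * (2 ^ (k + 2) * q) ^ 2) * r₂ ^ 2 := by
        rw [← hr, ← hr₂, ← h₂]; ring
      have key' := congrArg toReal key
      simp only [map_mul, map_pow, map_neg, map_add toReal (r₂ ^ 2), map_ofNat] at key'
      have p1 : 0 < toReal r ^ 2 * toReal (a - v₂) ^ 2 :=
        mul_pos (toReal_sq_pos hr0) (toReal_sq_pos (hne hu₂))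
      have p2 := mul_nonneg (add_nonneg (sq_nonneg (toReal r₂))
        (mul_nonneg toReal_two_add_phi_pos.le (sq_nonneg (2 ^ (k + 2) * toReal q))))
        (sq_nonneg (toReal r₂))
      linarith
  obtain ⟨r, hr⟩ : (a - v₁ - v₂) ∣ r₁ * r₂ := by
    rw [← IsIntegrallyClosed.pow_dvd_pow_iff two_ne_zero]
    exact ⟨(a - v₁) * (a - v₂), by rw [mul_pow, ← hr₁, ← hr₂]; ring⟩
  have hrr : (a - v₁) * (a - v₂) = r ^ 2 := by
    apply mul_left_cancel₀ (pow_ne_zero 2 (hne hu₃))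
    rw [← mul_pow, ← hr, mul_pow, ← hr₁, ← hr₂]; ring
  refine ⟨r, r₁, r₂, q, ⟨fun h' => not_two_dvd_mul hu₁ hu₂ ?_, ?_, ?_, ?_⟩⟩
  · rw [hrr]; exact dvd_pow h' two_ne_zero
  · have : 2 ∣ a - r := by
      apply two_dvd_sub_of_two_dvd_sq_sub_sq
      rw [← hrr, hw₁, hw₂]
      exact ⟨8 * ((w₁ + w₂) * a - 16 * w₁ * w₂), by ring⟩
    simpa using dvd_add h.two_dvd this
  · rw [← hrr, ← hr₁, ← h₁]; ring
  · rw [← hrr, ← hr₂, ← h₂]; ring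

theorem not_isDescentTuple (k : ℕ) :
    ∀ a b c q : GoldenInt, ¬ IsDescentTuple (k + 2) a b c q := by
  induction k with
  | zero => exact fun _ _ _ _ => not_isDescentTuple_two
  | succ k ih =>
    intro a b c q h
    obtain ⟨a', b', c', q', h'⟩ := h.exists_descent
    exact ih a' b' c' q' h'

/-! ### From the quartic form to the descent -/

theorem not_two_dvd_intCast {n : ℤ} (h : Odd n) : ¬ 2 ∣ (n : GoldenInt) := by
  obtain ⟨b, rfl⟩ := h
  intro h2
  push_cast at h2
  exact prime_two.not_isUnit (isUnit_of_dvd_one ((dvd_add_right (dvd_mul_right 2 _)).1 h2))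

theorem isCoprime_intCast {a b : ℤ} (h : IsCoprime a b) :
    IsCoprime (a : GoldenInt) (b : GoldenInt) :=
  h.map (Int.castRingHom GoldenInt)

theorem isCoprime_quartic_factors {n m z : GoldenInt} (hz : z ≠ 0) (hnm : IsCoprime n m)
    (h5 : IsCoprime 5 z)
    (h : (n ^ 2 + (2 * phi + 1) * n * m - (phi + 1) * m ^ 2) *
      (n ^ 2 - (2 * phi - 3) * n * m - (2 - phi) * m ^ 2) = z ^ 2) :
    IsCoprime (n ^ 2 + (2 * phi + 1) * n * m - (phi + 1) * m ^ 2)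
      (n ^ 2 - (2 * phi - 3) * n * m - (2 - phi) * m ^ 2) := by
  apply isCoprime_of_prime_dvd
  · rintro ⟨h1, -⟩
    rw [h1, zero_mul] at h
    exact pow_ne_zero 2 hz h.symm
  · intro p hp h1 h2
    have hpn : p ∣ n → ¬ p ∣ m := fun ha hb => hp.not_isUnit (hnm.isUnit_of_dvd' ha hb)
    have hsub : p ∣ (2 * phi - 1) * (m * (2 * n - m)) := by
      convert dvd_sub h1 h2 using 1; ring
    rcases hp.dvd_or_dvd hsub with h' | h'
    · refine hp.not_isUnit (h5.isUnit_of_dvd' ?_ (hp.dvd_of_dvd_pow (h ▸ Dvd.dvd.mul_right h1 _)))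
      have : (5 : GoldenInt) = (2 * phi - 1) * (2 * phi - 1) := by
        linear_combination -4 * phi_sq
      rw [this]
      exact Dvd.dvd.mul_right h' _
    · rcases hp.dvd_or_dvd h' with hm | ⟨t, ht⟩
      · refine hpn (hp.dvd_of_dvd_pow (n := 2) ?_) hm
        have := dvd_sub h1 (Dvd.dvd.mul_left hm ((2 * phi + 1) * n - (phi + 1) * m))
        convert this using 1; ring
      · have hn : p ∣ n := by
          apply hp.dvd_of_dvd_pow (n := 2)
          have := dvd_add h1 (Dvd.dvd.mul_right (dvd_mul_right p t)
            ((2 * phi + 1) * n - (phi + 1) * (m + 2 * n)))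
          rw [← dvd_neg]
          convert this using 1
          rw [← ht]; ring
        refine hpn hn ?_
        have : m = 2 * n - p * t := by linear_combination -ht
        rw [this]
        exact dvd_sub (Dvd.dvd.mul_left hn 2) (dvd_mul_right p t)

theorem squarefree_three_mul_phi_sq_mul : Squarefree (3 * phi ^ 2 * (2 + phi)) := by
  rw [squarefree_mul_iff]
  refine ⟨IsCoprime.isRelPrime ⟨2 * (2 - phi), -(3 - phi), ?_⟩, squarefree_three_mul_phi_sq,
    prime_two_add_phi.irreducible.squarefree⟩
  linear_combination (7 - 6 * phi) * phi_sq

theorem toReal_form_nonneg (u v : ℤ) :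
    0 ≤ toReal ((u : GoldenInt) ^ 2 + v ^ 2 - 2 * (2 * phi + 1) * (u * v)) := by
  have h1 := Real.neg_one_lt_goldenConj
  have h2 := Real.goldenConj_neg
  simp only [map_sub, map_add, map_mul, map_pow, map_one, map_ofNat, toReal_phi, toReal_intCast]
  nlinarith [sq_nonneg ((u : ℝ) - (2 * Real.goldenConj + 1) * v),
    mul_nonneg (mul_nonneg (sub_nonneg.2 h1.le) (neg_nonneg.2 h2.le)) (sq_nonneg (v : ℝ))]

/-- A coprime splitting `V * (a - V) = 3φ²(2 + φ)s²` with `a` positive under `toReal` and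
`a - V` congruent to an odd square. -/
theorem exists_sq_of_mul_sub {a s u V : GoldenInt} (ha : 0 ≤ toReal a) (hu : ¬ 2 ∣ u)
    (h8 : 8 ∣ a - V - u ^ 2) (hcop : IsCoprime V (a - V))
    (h : V * (a - V) = 3 * phi ^ 2 * (2 + phi) * s ^ 2) :
    ∃ g h, a - V = g ^ 2 ∧ V = 3 * phi ^ 2 * (2 + phi) * h ^ 2 ∧ g * h = s := by
  set U := a - V with hU
  have hodd : ¬ 2 ∣ U := not_two_dvd_of_dvd_sub (y := u ^ 2)
    (dvd_trans ⟨4, by norm_num⟩ h8) fun h' => hu (two_dvd_of_two_dvd_pow h')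
  have hu2 : IsUnit (phi ^ 2) := isUnit_phi.pow 2
  rcases prime_three.dvd_or_dvd (a := V) (b := U) ⟨phi ^ 2 * (2 + phi) * s ^ 2, by rw [h]; ring⟩
    with ⟨V', hV'⟩ | ⟨U', hU'⟩
  · have h3 : V' * U = phi ^ 2 * (2 + phi) * s ^ 2 :=
      mul_left_cancel₀ prime_three.ne_zero (by linear_combination h - U * hV')
    rw [hV'] at hcop
    have hcop' := hcop.of_mul_left_right
    rcases prime_two_add_phi.dvd_or_dvd (a := V') (b := U)
      ⟨phi ^ 2 * s ^ 2, by rw [h3]; ring⟩ with ⟨W, hW⟩ | ⟨W, hW⟩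
    · have h5 : U * W = phi ^ 2 * s ^ 2 :=
        mul_left_cancel₀ prime_two_add_phi.ne_zero (by linear_combination h3 - U * hW)
      rw [hW] at hcop'
      obtain ⟨e, y, he, hy⟩ := exists_unit_mul_sq hu2 hcop'.of_mul_left_right.symm h5
      obtain ⟨g, hg⟩ := exists_eq_sq he hy hu h8
      have hg0 : g ≠ 0 := by
        rintro rfl
        exact hodd (by rw [hg]; simp)
      obtain ⟨k, hk⟩ : g ∣ phi * s := by
        rw [← IsIntegrallyClosed.pow_dvd_pow_iff two_ne_zero]
        exact ⟨W, by rw [← hg, h5]; ring⟩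
      have hWk : W = k ^ 2 := by
        apply mul_left_cancel₀ (pow_ne_zero 2 hg0)
        rw [← hg, h5, hg, ← mul_pow, hk, mul_pow]
      refine ⟨g, (phi - 1) * k, hg, ?_, ?_⟩
      · rw [hV', hW, hWk]
        linear_combination -3 * (2 + phi) * k ^ 2 * (phi * (phi - 1) + 1) * phi_mul_phi_sub_one
      · linear_combination -(phi - 1) * hk + s * phi_mul_phi_sub_one
    · have h5 : W * V' = phi ^ 2 * s ^ 2 :=
        mul_left_cancel₀ prime_two_add_phi.ne_zero (by linear_combination h3 - V' * hW)
      rw [hW] at hcop'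
      obtain ⟨e, y, he, hy⟩ := exists_unit_mul_sq hu2 hcop'.of_mul_right_right.symm h5
      exact (false_of_norm_eq_five (c := 2 + phi) (y := y) he (by rw [hW, hy]; ring) hu h8
        (by rw [norm_two_add_phi]; simp)).elim
  · have h3 : V * U' = phi ^ 2 * (2 + phi) * s ^ 2 :=
      mul_left_cancel₀ prime_three.ne_zero (by linear_combination h - V * hU')
    rw [hU'] at hcop
    have hcop' := hcop.of_mul_right_right
    rcases prime_two_add_phi.dvd_or_dvd (a := V) (b := U')
      ⟨phi ^ 2 * s ^ 2, by rw [h3]; ring⟩ with ⟨W, hW⟩ | ⟨W, hW⟩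
    · have h5 : U' * W = phi ^ 2 * s ^ 2 :=
        mul_left_cancel₀ prime_two_add_phi.ne_zero (by linear_combination h3 - U' * hW)
      rw [hW] at hcop'
      obtain ⟨e, y, he, hy⟩ := exists_unit_mul_sq hu2 hcop'.of_mul_left_right.symm h5
      obtain ⟨b, hb⟩ := exists_eq_sq_or_eq_neg_three_mul (y := y) he (by rw [hU', hy]; ring) hu h8
      exfalso
      have hb0 : b ≠ 0 := by
        rintro rfl
        exact hodd (by rw [hb]; simp)
      have hUneg : toReal U < 0 := by
        rw [hb]
        simp only [map_neg, map_mul, map_ofNat, map_pow]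
        linarith [toReal_sq_pos hb0]
      have hVpos : 0 < toReal V := by
        have : V = a - U := by rw [hU]; ring
        rw [this, map_sub]
        linarith
      have hprod := congrArg toReal h
      have hnonneg : 0 ≤ toReal (3 * phi ^ 2 * (2 + phi) * s ^ 2) := by
        rw [map_mul, map_mul, map_mul, map_pow, map_pow, map_ofNat]
        have := toReal_two_add_phi_pos
        positivity
      rw [← hprod, map_mul] at hnonneg
      nlinarith
    · have h5 : W * V = phi ^ 2 * s ^ 2 :=
        mul_left_cancel₀ prime_two_add_phi.ne_zero (by linear_combination h3 - V * hW)
      rw [hW] at hcop'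
      obtain ⟨e, y, he, hy⟩ := exists_unit_mul_sq hu2 hcop'.of_mul_right_right.symm h5
      exact (false_of_norm_eq_five (c := 3 * (2 + phi)) (y := y) he (by rw [hU', hW, hy]; ring) hu
        h8 (by rw [map_mul, norm_two_add_phi]; simp [norm_eq])).elim

/-- A solution of `u² + v² - 2φ³uv = g² + 3φ²(2 + φ)h²`, `gh = uv` yields a descent tuple. -/
theorem exists_isDescentTuple {k : ℕ} {u v g h : GoldenInt} (hu : ¬ 2 ∣ u) (h2 : 2 ∣ h - u)
    (hgh : g * (2 ^ (k + 2) * h) = u * v)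
    (heq : u ^ 2 + v ^ 2 - 2 * (2 * phi + 1) * (u * v) =
      g ^ 2 + 3 * phi ^ 2 * (2 + phi) * (2 ^ (k + 2) * h) ^ 2) :
    ∃ a b c q, IsDescentTuple (k + 2) a b c q := by
  set h' := 2 ^ (k + 2) * h with hh'
  have hY : (u ^ 2 - 3 * phi ^ 2 * h' ^ 2) * (u ^ 2 - (2 + phi) * h' ^ 2) =
      (v * h' - u * g - (2 * phi + 1) * u * h') ^ 2 := by
    linear_combination (u ^ 2 - h' ^ 2) * heq
      - (g * h' - u * v + 2 * (2 * phi + 1) * u ^ 2) * hgh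
      + u ^ 2 * h' ^ 2 * (3 * phi + 2) * phi_sq
  have hu0 : u ≠ 0 := fun h0 => hu (h0 ▸ dvd_zero 2)
  obtain ⟨e, a, q, rfl, rfl, hcop⟩ := exists_eq_mul_isCoprime h hu0
  have he : e ≠ 0 := left_ne_zero_of_mul hu0
  have hodd : ¬ 2 ∣ a := fun h' => hu (Dvd.dvd.mul_left h' e)
  set s := 2 ^ (k + 2) * q with hs
  have hes : h' = e * s := by rw [hh', hs]; ring
  obtain ⟨y, hy⟩ : e ^ 2 ∣ v * h' - e * a * g - (2 * phi + 1) * (e * a) * h' := by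
    rw [← IsIntegrallyClosed.pow_dvd_pow_iff two_ne_zero, ← hY, hes]
    exact ⟨(a ^ 2 - 3 * phi ^ 2 * s ^ 2) * (a ^ 2 - (2 + phi) * s ^ 2), by ring⟩
  have hsq : (a ^ 2 - 3 * phi ^ 2 * s ^ 2) * (a ^ 2 - (2 + phi) * s ^ 2) = y ^ 2 := by
    apply mul_left_cancel₀ (pow_ne_zero 4 he)
    rw [hy, hes] at hY
    linear_combination hY
  have has : IsCoprime a s := IsCoprime.mul_right (isCoprime_two_pow hodd _).symm hcop
  have hfac : IsCoprime (a ^ 2 - 3 * phi ^ 2 * s ^ 2) (a ^ 2 - (2 + phi) * s ^ 2) := by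
    apply isCoprime_of_prime_dvd
    · rintro ⟨h1, h2⟩
      have hs0 : phi ^ 3 * s ^ 2 = 0 := by
        linear_combination h2 - h1 + s ^ 2 * (phi - 2) * phi_sq
      have hs0 : s = 0 := by
        simpa [isUnit_phi.ne_zero] using hs0
      have ha0 : a = 0 := by simpa [hs0] using h1
      exact hodd (ha0 ▸ dvd_zero 2)
    · intro p hp h1 h2
      have h3 : p ∣ phi ^ 3 * s ^ 2 := by
        convert dvd_sub h2 h1 using 1
        linear_combination s ^ 2 * (phi - 2) * phi_sq
      have h4 : p ∣ s := hp.dvd_of_dvd_pow ((isUnit_phi.pow 3).dvd_mul_left.1 h3)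
      have h5 : p ∣ a := by
        apply hp.dvd_of_dvd_pow (n := 2)
        exact (dvd_sub_left (Dvd.dvd.mul_left (dvd_pow h4 two_ne_zero) _)).1 h1
      exact hp.not_isUnit (has.isUnit_of_dvd' h5 h4)
  have h8 : ∀ c, 8 ∣ a ^ 2 - c * s ^ 2 - a ^ 2 := fun c =>
    ⟨-2 * c * (2 ^ k * q) ^ 2, by rw [hs]; ring⟩
  obtain ⟨e₁, y₁, he₁, hy₁⟩ := exists_unit_mul_sq isUnit_one hfac (by rw [hsq, one_mul])
  obtain ⟨e₂, y₂, he₂, hy₂⟩ := exists_unit_mul_sq isUnit_one hfac.symm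
    (by rw [mul_comm, hsq, one_mul])
  obtain ⟨b, hb⟩ := exists_eq_sq he₁ hy₁ hodd (h8 _)
  obtain ⟨c, hc⟩ := exists_eq_sq he₂ hy₂ hodd (h8 _)
  refine ⟨a, b, c, q, hodd, ?_, by rw [← hb]; ring, by rw [← hc]; ring⟩
  rw [← mul_sub] at h2
  exact (prime_two.dvd_or_dvd h2).resolve_left fun h' => hu (Dvd.dvd.mul_right h' a)

theorem exists_eq_two_pow_mul_odd {v : ℤ} (hv : v ≠ 0) (h4 : 4 ∣ v) :
    ∃ (k : ℕ) (w : ℤ), v = 2 ^ (k + 2) * (2 * w + 1) := by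
  have hfin : FiniteMultiplicity 2 v := Int.finiteMultiplicity_iff.2 ⟨by norm_num, hv⟩
  obtain ⟨c, hc, hc2⟩ := hfin.exists_eq_pow_mul_and_not_dvd
  obtain ⟨w, hw⟩ : Odd c := by rwa [← Int.not_even_iff_odd, even_iff_two_dvd]
  have h2 : 2 ≤ multiplicity 2 v := hfin.le_multiplicity_of_pow_dvd (by simpa using h4)
  obtain ⟨k, hk⟩ := Nat.exists_eq_add_of_le' h2
  exact ⟨k, w, by rw [hc, hk, hw]⟩

/-- The form `n⁴ + 4n³m - 4n²m² - nm³ + m⁴` at `n = u² + v²`, `m = -4uv` is not a square. -/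
theorem quartic_ne_sq {u v n m z : ℤ} (hu : Odd u) (h4 : 4 ∣ v) (hv : v ≠ 0)
    (huv : IsCoprime u v) (hn : n = u ^ 2 + v ^ 2) (hm : m = -4 * (u * v)) (h5 : ¬ 5 ∣ z) :
    n ^ 4 + 4 * n ^ 3 * m - 4 * n ^ 2 * m ^ 2 - n * m ^ 3 + m ^ 4 ≠ z ^ 2 := by
  intro hF
  have hz : z ≠ 0 := fun h0 => h5 (h0 ▸ dvd_zero 5)
  have hodd : Odd n := by
    rw [hn]
    exact hu.pow.add_even ((even_iff_two_dvd.2 (dvd_trans (by norm_num) h4)).pow_of_ne_zero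
      two_ne_zero)
  have hnuv : IsCoprime n (u * v) := hn ▸ isCoprime_sq_add_sq_mul huv
  have hnm : IsCoprime n m := by
    rw [hn] at hodd
    rw [hn, hm]
    exact isCoprime_sq_add_sq_neg_four_mul huv hodd
  have h5z : IsCoprime 5 z :=
    (Irreducible.coprime_iff_not_dvd (Int.prime_iff_natAbs_prime.2 (by norm_num)).irreducible).2 h5
  have hFR : (n : GoldenInt) ^ 4 + 4 * n ^ 3 * m - 4 * n ^ 2 * m ^ 2 - n * m ^ 3 + m ^ 4 = z ^ 2 := by
    exact_mod_cast congrArg (Int.cast : ℤ → GoldenInt) hF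
  have hnR : (n : GoldenInt) = u ^ 2 + v ^ 2 := by rw [hn]; push_cast; rfl
  have hmR : (m : GoldenInt) = -4 * (u * v) := by rw [hm]; push_cast; rfl
  have hprod : ((n : GoldenInt) ^ 2 + (2 * phi + 1) * n * m - (phi + 1) * m ^ 2) *
      (n ^ 2 - (2 * phi - 3) * n * m - (2 - phi) * m ^ 2) = (z : GoldenInt) ^ 2 := by
    linear_combination hFR
      + (-4 * (n : GoldenInt) ^ 2 * m ^ 2 + 4 * n * m ^ 3 - m ^ 4) * phi_sq
  have hcop := isCoprime_quartic_factors (by exact_mod_cast hz) (isCoprime_intCast hnm)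
    (by exact_mod_cast isCoprime_intCast h5z) hprod
  obtain ⟨e, y, he, hy⟩ := exists_unit_mul_sq isUnit_one hcop (by rw [hprod, one_mul])
  obtain ⟨w, hw⟩ := h4
  have hwR : (v : GoldenInt) = 4 * w := by rw [hw]; push_cast; rfl
  obtain ⟨c, hc⟩ := exists_eq_sq he hy (not_two_dvd_intCast hodd)
    ⟨-2 * u * w * (2 * phi + 1) * n - 32 * (phi + 1) * u ^ 2 * w ^ 2, by
      rw [hmR, hwR]; ring⟩
  set a : GoldenInt := u ^ 2 + v ^ 2 - 2 * (2 * phi + 1) * (u * v) with ha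
  have hac : a ^ 2 - c ^ 2 = 3 * phi ^ 2 * (2 + phi) * (2 * (u * v)) ^ 2 := by
    rw [← hc, hmR, hnR]
    linear_combination -(12 * phi + 20) * ((u : GoldenInt) * v) ^ 2 * phi_sq
  obtain ⟨V, hV2, hV⟩ := exists_even_mul_sub hac ⟨2 * u * w, by rw [hwR]; ring⟩
  have hnR2 := not_two_dvd_intCast hodd
  have haodd : ¬ 2 ∣ a := not_two_dvd_of_dvd_sub (y := (n : GoldenInt))
    ⟨-(2 * phi + 1) * (u * v), by rw [hnR, ha]; ring⟩ hnR2
  obtain ⟨t, ht⟩ := two_pow_dvd_of_mul_sub (n := 2) haodd hV2 hV ⟨u * w, by rw [hwR]; ring⟩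
  have hauv : IsCoprime a ((u : GoldenInt) * v) := by
    have h1 := isCoprime_intCast hnuv
    push_cast at h1
    have : a = n + (u * v) * (-2 * (2 * phi + 1)) := by rw [hnR, ha]; ring
    rw [this]
    exact h1.add_mul_left_left _
  have huodd := not_two_dvd_intCast hu
  obtain ⟨g, h, hg, hh, hgh⟩ := exists_sq_of_mul_sub (toReal_form_nonneg u v) huodd
    ⟨2 * w ^ 2 - (2 * phi + 1) * (u * w) - 2 * t, by rw [ht, hwR]; ring⟩
    (isCoprime_of_mul_sub squarefree_three_mul_phi_sq_mul hauv hV) hV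
  have hgodd : ¬ 2 ∣ g := fun h' => not_two_dvd_sub haodd hV2 (by
    rw [hg]; exact dvd_pow h' two_ne_zero)
  obtain ⟨k, v', hv'⟩ := exists_eq_two_pow_mul_odd hv ⟨w, hw⟩
  have hvR : (v : GoldenInt) = 2 ^ (k + 2) * (2 * v' + 1) := by rw [hv']; push_cast; rfl
  obtain ⟨h', rfl⟩ : 2 ^ (k + 2) ∣ h := by
    apply (isCoprime_two_pow hgodd _).dvd_of_dvd_mul_left
    rw [hgh, hvR]
    exact ⟨u * (2 * v' + 1), by ring⟩
  have hgh' : g * h' = u * (2 * v' + 1) := by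
    apply mul_left_cancel₀ (pow_ne_zero (k + 2) prime_two.ne_zero)
    rw [hvR] at hgh
    linear_combination hgh
  have hgu : 2 ∣ g - u := by
    apply two_dvd_sub_of_two_dvd_sq_sub_sq
    rw [← hg, ht, hwR]
    exact ⟨8 * w ^ 2 - 4 * (2 * phi + 1) * (u * w) - 8 * t, by ring⟩
  have hh'u : 2 ∣ h' - u := by
    obtain ⟨r, hr⟩ := hgu
    obtain ⟨b, hb⟩ := hu
    have hbR : (u : GoldenInt) = 2 * b + 1 := by rw [hb]; push_cast; rfl
    refine ⟨v' * u - b * h' - r * h' , ?_⟩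
    linear_combination hgh' - h' * hr - h' * hbR
  obtain ⟨a', b', c', q', hT⟩ := exists_isDescentTuple huodd hh'u hgh
    (by rw [← hh, ← hg]; ring)
  exact not_isDescentTuple _ _ _ _ _ hT

end GoldenInt

theorem eq_sq_of_isCoprime {a b c : ℤ} (hab : IsCoprime a b) (h : a * b = c ^ 2)
    (ha : 4 ∣ a - 1) : ∃ w, a = w ^ 2 := by
  obtain ⟨w, hw | hw⟩ := Int.sq_of_isCoprime hab h
  · exact ⟨w, hw⟩
  · exfalso
    obtain ⟨b, hb | hb⟩ := Int.even_or_odd' w <;> rw [hw, hb] at ha <;> ring_nf at ha <;> omega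

theorem even_of_sq_sub_eight_mul {u w x y : ℤ} (hu : Odd u)
    (h : u ^ 2 - 8 * x + 4 * y ^ 2 = w ^ 2) : Even y := by
  obtain ⟨a, rfl⟩ := hu
  obtain ⟨b, hb⟩ := Int.even_mul_succ_self a
  by_contra hy
  rw [Int.not_even_iff_odd] at hy
  obtain ⟨c, rfl⟩ := hy
  have h' : w ^ 2 = 8 * (b - x + 2 * c ^ 2 + 2 * c) + 5 := by linear_combination -h + 4 * hb
  obtain ⟨d, rfl | rfl⟩ := Int.even_or_odd' w
  · ring_nf at h'; omega
  · obtain ⟨e, he⟩ := Int.even_mul_succ_self d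
    have : 8 * e + 1 = 8 * (b - x + 2 * c ^ 2 + 2 * c) + 5 := by linear_combination h' - 4 * he
    omega

theorem not_five_dvd_of_isCoprime {u v : ℤ} (huv : IsCoprime u v) :
    ¬ 5 ∣ u ^ 2 + v ^ 2 + -4 * (u * v) := by
  intro h
  have key : ∀ a b : ZMod 5, a ^ 2 + b ^ 2 + -4 * (a * b) = 0 → a = 0 ∧ b = 0 := by decide
  have := key u v (by exact_mod_cast (ZMod.intCast_zmod_eq_zero_iff_dvd _ 5).2 h)
  rw [ZMod.intCast_zmod_eq_zero_iff_dvd, ZMod.intCast_zmod_eq_zero_iff_dvd] at this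
  have h5 := huv.isUnit_of_dvd' this.1 this.2
  rw [Int.isUnit_iff] at h5
  norm_num at h5

/-- The form `P² - 4PQ + Q²`, where `P + iQ = (u + iv)⁵`, is a square only if `v = 0`. -/
theorem eq_zero_of_form_eq_sq {u v x P Q : ℤ} (hu : Odd u) (hv : Even v) (huv : IsCoprime u v)
    (hP : P = u ^ 5 - 10 * u ^ 3 * v ^ 2 + 5 * u * v ^ 4)
    (hQ : Q = 5 * u ^ 4 * v - 10 * u ^ 2 * v ^ 3 + v ^ 5)
    (h : P ^ 2 - 4 * P * Q + Q ^ 2 = x ^ 2) : v = 0 := by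
  by_contra hv0
  obtain ⟨n, hn⟩ : ∃ n, n = u ^ 2 + v ^ 2 := ⟨_, rfl⟩
  obtain ⟨m, hm⟩ : ∃ m, m = -4 * (u * v) := ⟨_, rfl⟩
  obtain ⟨F, hF⟩ : ∃ F, F = n ^ 4 + 4 * n ^ 3 * m - 4 * n ^ 2 * m ^ 2 - n * m ^ 3 + m ^ 4 :=
    ⟨_, rfl⟩
  have hprod : (n + m) * F = x ^ 2 := by
    rw [hF, ← h, hP, hQ, hn, hm]; ring
  have h5L : ¬ 5 ∣ n + m := by rw [hn, hm]; exact not_five_dvd_of_isCoprime huv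
  have hp5 : Prime (5 : ℤ) := Int.prime_iff_natAbs_prime.2 (by norm_num)
  obtain ⟨y, hy⟩ := hv.two_dvd
  obtain ⟨a, ha⟩ := id hu
  have hn4 : n = 1 + 4 * (a ^ 2 + a + y ^ 2) := by rw [hn, ha, hy]; ring
  have hm4 : m = 4 * (-(u * v)) := by rw [hm]; ring
  have hodd : Odd n := ⟨2 * (a ^ 2 + a + y ^ 2), by rw [hn4]; ring⟩
  have hnm : IsCoprime n m := by
    rw [hn] at hodd
    rw [hn, hm]
    exact isCoprime_sq_add_sq_neg_four_mul huv hodd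
  have hLn : IsCoprime (n + m) n := by
    have := hnm.symm.add_mul_left_left 1
    rwa [mul_one, add_comm] at this
  have hLF : IsCoprime (n + m) F := by
    have h5 : IsCoprime (n + m) 5 := ((Irreducible.coprime_iff_not_dvd hp5.irreducible).2 h5L).symm
    have : F = -(5 * n ^ 4) + (n + m) * (6 * n ^ 3 - 2 * n ^ 2 * m - 2 * n * m ^ 2 + m ^ 3) := by
      rw [hF]; ring
    rw [this]
    exact (h5.mul_right hLn.pow_right).neg_right.add_mul_left_right _
  obtain ⟨w, hw⟩ := eq_sq_of_isCoprime hLF hprod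
    ⟨a ^ 2 + a + y ^ 2 - u * v, by rw [hm4, hn4]; ring⟩
  obtain ⟨z, hz⟩ := eq_sq_of_isCoprime hLF.symm (by rw [mul_comm]; exact hprod) (by
    obtain ⟨r, hr⟩ : ∃ r, n = 1 + 4 * r := ⟨_, hn4⟩
    obtain ⟨s, hs⟩ : ∃ s, m = 4 * s := ⟨_, hm4⟩
    refine ⟨4 * r + 24 * r ^ 2 + 64 * r ^ 3 + 64 * r ^ 4
      + s * (4 * n ^ 3 - 4 * n ^ 2 * m - n * m ^ 2 + m ^ 3), ?_⟩
    rw [hF, hs, hr]; ring)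
  have h5z : ¬ 5 ∣ z := by
    intro h'
    apply h5L
    apply hp5.dvd_of_dvd_pow (n := 4)
    have : (n + m) ^ 4 = z ^ 2 + 5 * (2 * n ^ 2 * m ^ 2 + n * m ^ 3) := by
      rw [← hz, hF]; ring
    rw [this]
    exact dvd_add (dvd_pow h' two_ne_zero) (dvd_mul_right 5 _)
  have h4v : 4 ∣ v := by
    obtain ⟨b, hb⟩ := even_of_sq_sub_eight_mul (u := u) (w := w) (x := u * y) (y := y) hu
      (by rw [← hw, hn, hm, hy]; ring)
    exact ⟨b, by rw [hy, hb]; ring⟩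
  exact GoldenInt.quartic_ne_sq hu h4v hv0 huv hn hm h5z (hF ▸ hz)

namespace GaussianInt

theorem isCoprime_intCast {a b : ℤ} (h : IsCoprime a b) :
    IsCoprime (a : GaussianInt) (b : GaussianInt) :=
  h.map (Int.castRingHom GaussianInt)

theorem pow_four_eq_one {e : GaussianInt} (he : IsUnit e) : e ^ 4 = 1 := by
  have h2 : e.re * e.re + e.im * e.im = 1 := by
    have h1 := (Zsqrtd.norm_eq_one_iff' (by norm_num) e).2 he
    rw [Zsqrtd.norm_def] at h1
    linarith
  have hre : -1 ≤ e.re ∧ e.re ≤ 1 := ⟨by nlinarith, by nlinarith⟩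
  have him : -1 ≤ e.im ∧ e.im ≤ 1 := ⟨by nlinarith, by nlinarith⟩
  obtain ⟨x, y⟩ := e
  simp only at h2 hre him
  obtain ⟨hx1, hx2⟩ := hre
  obtain ⟨hy1, hy2⟩ := him
  interval_cases x <;> interval_cases y <;> first | omega | rfl

/-- If `P² + Q²` is a fifth power with `P`, `Q` coprime of opposite parity, then `P + iQ` is a
fifth power. -/
theorem exists_fifth_power {P Q x : ℤ} (hPQ : IsCoprime P Q) (hx : Odd x)
    (h : P ^ 2 + Q ^ 2 = x ^ 5) :
    ∃ u v : ℤ, P = u ^ 5 - 10 * u ^ 3 * v ^ 2 + 5 * u * v ^ 4 ∧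
      Q = 5 * u ^ 4 * v - 10 * u ^ 2 * v ^ 3 + v ^ 5 := by
  have hprod : (⟨P, Q⟩ : GaussianInt) * ⟨P, -Q⟩ = (x : GaussianInt) ^ 5 := by
    rw [← Int.cast_pow, ← h]
    ext
    · simp [pow_two]
    · simp [pow_two, mul_comm]
  have hcop : IsCoprime (⟨P, Q⟩ : GaussianInt) ⟨P, -Q⟩ := by
    have h2 : IsCoprime (2 : GaussianInt) x := by
      exact_mod_cast isCoprime_intCast (Int.isCoprime_two_left.2 hx)
    apply isCoprime_of_prime_dvd
    · rintro ⟨h1, -⟩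
      rw [h1, zero_mul] at hprod
      have hx0 : (x : GaussianInt) = 0 := pow_eq_zero_iff (n := 5) (by norm_num) |>.1 hprod.symm
      have : x = 0 := by exact_mod_cast hx0
      rw [this] at hx
      exact absurd hx (by decide)
    · intro p hp h1 h2'
      have hpx : p ∣ (x : GaussianInt) :=
        hp.dvd_of_dvd_pow (n := 5) (hprod ▸ Dvd.dvd.mul_right h1 _)
      have hp2 : ¬ p ∣ 2 := fun h' => hp.not_isUnit (h2.isUnit_of_dvd' h' hpx)
      have hpP : p ∣ 2 * (P : GaussianInt) := by
        convert dvd_add h1 h2' using 1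
        ext <;> simp; ring
      have hpQ : p ∣ 2 * (Q : GaussianInt) := by
        convert Dvd.dvd.mul_left (dvd_sub h1 h2') (⟨0, -1⟩ : GaussianInt) using 1
        ext <;> simp; ring
      exact hp.not_isUnit ((isCoprime_intCast hPQ).isUnit_of_dvd'
        ((hp.dvd_or_dvd hpP).resolve_left hp2) ((hp.dvd_or_dvd hpQ).resolve_left hp2))
  obtain ⟨d, e, hd⟩ := exists_associated_pow_of_mul_eq_pow' hcop hprod
  have he := pow_four_eq_one e.isUnit
  have hfive : (⟨P, Q⟩ : GaussianInt) = (d * e) ^ 5 := by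
    rw [← hd]; linear_combination -d ^ 5 * (e : GaussianInt) * he
  obtain ⟨⟨u, v⟩, huv⟩ : ∃ w : GaussianInt, w = d * e := ⟨_, rfl⟩
  rw [← huv] at hfive
  have hre := congrArg Zsqrtd.re hfive
  have him := congrArg Zsqrtd.im hfive
  simp only [pow_succ, pow_zero, one_mul, Zsqrtd.re_mul, Zsqrtd.im_mul] at hre him
  exact ⟨u, v, by rw [hre]; ring, by rw [him]; ring⟩

end GaussianInt

/-- There is no primitive non-constant arithmetic progression of integers of the
form `x₁², x₂², x₃⁵, x₄²`. -/
theorem no_AP_2252 :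
    ¬ ∃ (x₁ x₂ x₃ x₄ d : ℤ), d ≠ 0 ∧
      Int.gcd (x₁ ^ 2) (x₂ ^ 2) = 1 ∧
      x₂ ^ 2 - x₁ ^ 2 = d ∧
      x₃ ^ 5 - x₂ ^ 2 = d ∧
      x₄ ^ 2 - x₃ ^ 5 = d := by
  rintro ⟨x₁, x₂, x₃, x₄, d, hd, hgcd, h₁, h₂, h₃⟩
  rw [← Int.isCoprime_iff_gcd_eq_one] at hgcd
  have h12 : ∀ p : ℤ, Prime p → p ∣ x₂ → p ∣ x₃ → False := fun p hp hp2 hp3 =>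
    hp.not_isUnit (hgcd.isUnit_of_dvd' (by
      have : x₁ ^ 2 = 2 * x₂ ^ 2 - x₃ ^ 5 := by linear_combination h₂ - h₁
      rw [this]
      exact dvd_sub (Dvd.dvd.mul_left (dvd_pow hp2 two_ne_zero) 2) (dvd_pow hp3 (by norm_num)))
      (dvd_pow hp2 two_ne_zero))
  obtain ⟨Q, hQ⟩ : (2 : ℤ) ∣ x₄ - x₂ := by
    apply Int.prime_two.dvd_of_dvd_pow (n := 2)
    exact ⟨x₃ ^ 5 - x₄ * x₂, by linear_combination h₃ - h₂⟩
  obtain ⟨P, hP⟩ : ∃ P, P = x₂ + Q := ⟨_, rfl⟩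
  have hx2 : x₂ = P - Q := by linear_combination -hP
  have hx4 : x₄ = P + Q := by linear_combination hQ - hP
  have hsum : P ^ 2 + Q ^ 2 = x₃ ^ 5 := by
    rw [hx2] at h₂
    rw [hx4] at h₃
    linarith
  have hPQ : IsCoprime P Q := by
    apply isCoprime_of_prime_dvd
    · rintro ⟨rfl, rfl⟩
      have h3 : x₃ = 0 := by
        rw [← pow_eq_zero_iff (n := 5) (by norm_num), ← hsum]; norm_num
      exact h12 2 Int.prime_two (by rw [hx2]; norm_num) (by rw [h3]; norm_num)
    · intro p hp hpP hpQ
      refine h12 p hp (by rw [hx2]; exact dvd_sub hpP hpQ) (hp.dvd_of_dvd_pow (n := 5) ?_)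
      rw [← hsum]
      exact dvd_add (dvd_pow hpP two_ne_zero) (dvd_pow hpQ two_ne_zero)
  have hpar : Even x₃ ↔ Even x₂ := by
    have h := congrArg Even hsum
    rw [hx2]
    simp only [Int.even_add, Int.even_sub, Int.even_pow, eq_iff_iff] at h ⊢
    tauto
  have hx3 : Odd x₃ := by
    rw [← Int.not_even_iff_odd]
    intro h
    exact h12 2 Int.prime_two (hpar.1 h).two_dvd h.two_dvd
  have hx2odd : ¬ Even x₂ := fun h => Int.not_even_iff_odd.2 hx3 (hpar.2 h)
  have hform : P ^ 2 - 4 * P * Q + Q ^ 2 = x₁ ^ 2 := by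
    rw [hx2] at h₁ h₂
    linarith
  have hd2 : d = 2 * P * Q := by
    rw [← h₂, ← hsum, hx2]; ring
  obtain ⟨u, v, hPu, hQu⟩ := GaussianInt.exists_fifth_power hPQ hx3 hsum
  have huv : IsCoprime u v := by
    have hPdvd : ∀ p : ℤ, p ∣ u → p ∣ P := by
      rintro p ⟨t, rfl⟩
      exact ⟨t * ((p * t) ^ 4 - 10 * (p * t) ^ 2 * v ^ 2 + 5 * v ^ 4), by rw [hPu]; ring⟩
    have hQdvd : ∀ p : ℤ, p ∣ v → p ∣ Q := by
      rintro p ⟨t, rfl⟩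
      exact ⟨t * (5 * u ^ 4 - 10 * u ^ 2 * (p * t) ^ 2 + (p * t) ^ 4), by rw [hQu]; ring⟩
    exact (hPQ.of_isCoprime_of_dvd_left (hPdvd u dvd_rfl)).of_isCoprime_of_dvd_right
      (hQdvd v dvd_rfl)
  have hparity : (Odd u ∧ Even v) ∨ (Odd v ∧ Even u) := by
    rw [hx2, hPu, hQu] at hx2odd
    have h10 : Even (10 : ℤ) := by decide
    by_cases hu : Even u <;> by_cases hv : Even v <;>
    simp [Int.even_add, Int.even_sub, Int.even_pow, Int.even_mul, h10, hu, hv] at hx2odd ⊢ <;>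
    exact Int.not_even_iff_odd.1 ‹_›
  apply hd
  rw [hd2]
  rcases hparity with ⟨hu, hv⟩ | ⟨hv, hu⟩
  · have hv0 := eq_zero_of_form_eq_sq hu hv huv hPu hQu hform
    rw [hQu, hv0]; ring
  · have hu0 := eq_zero_of_form_eq_sq (P := Q) (Q := P) (x := x₁) hv hu huv.symm
      (by rw [hQu]; ring) (by rw [hPu]; ring) (by rw [← hform]; ring)
    rw [hPu, hu0]; ring
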